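/- arXiv:2603.00261 — 2 statements merged into one kernel-verified Lean document; each statement's English description precedes it below -/
import Mathlib

section
/- There exists a constant C > 0, depending only on Ω and the constants D_1,…,D_l, such that for every ψ in the class W one has ‖∇ψ‖_{L⁴(Ω)} ≤ C ‖∇ψ‖_{L²(Ω)}^{1/2} ‖ψ‖_W^{1/2}, where the gradient is computed layerwise. -/
open MeasureTheory Set

noncomputable section

/-- Horizontal partial derivative `∂ₓ f`. -/
def dX (f : ℝ × ℝ → ℝ) (q : ℝ × ℝ) : ℝ := fderiv ℝ f q (1, 0)

/-- Vertical partial derivative `∂_z f`. -/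
def dZ (f : ℝ × ℝ → ℝ) (q : ℝ × ℝ) : ℝ := fderiv ℝ f q (0, 1)

/-- The domain `Ω = (0,L) × (−H,0)`. -/
def Om (L H : ℝ) : Set (ℝ × ℝ) := Set.Ioo 0 L ×ˢ Set.Ioo (-H) 0

/-- The `i`-th layer `(0,L) × (z_i, z_{i+1})`. -/
def strip (L : ℝ) (z : ℕ → ℝ) (i : ℕ) : Set (ℝ × ℝ) :=
  Set.Ioo 0 L ×ˢ Set.Ioo (z i) (z (i + 1))

/-- Squared `L²` norm on a set. -/
def sqInt (S : Set (ℝ × ℝ)) (f : ℝ × ℝ → ℝ) : ℝ := ∫ q in S, (f q) ^ 2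

/-- `L²` norm on a set. -/
def l2 (S : Set (ℝ × ℝ)) (f : ℝ × ℝ → ℝ) : ℝ := Real.sqrt (sqInt S f)

/-- Squared pointwise norm of the gradient. -/
def gradSq (f : ℝ × ℝ → ℝ) (q : ℝ × ℝ) : ℝ := (dX f q) ^ 2 + (dZ f q) ^ 2

/-- `L²` norm of the gradient on a set. -/
def l2grad (S : Set (ℝ × ℝ)) (f : ℝ × ℝ → ℝ) : ℝ := Real.sqrt (∫ q in S, gradSq f q)

/-- `H¹` norm on a set. -/
def h1 (S : Set (ℝ × ℝ)) (f : ℝ × ℝ → ℝ) : ℝ :=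
  Real.sqrt (sqInt S f + ∫ q in S, gradSq f q)

/-- The layered structure of the domain: `l` layers separated by the heights `z i`,
with `z 0 = −H < z 1 < ⋯ < z l = 0`. -/
structure Layers (L H : ℝ) (l : ℕ) (z : ℕ → ℝ) : Prop where
  hL : 0 < L
  hH : 0 < H
  hl : 0 < l
  z0 : z 0 = -H
  zl : z l = 0
  mono : ∀ i < l, z i < z (i + 1)

/-- `L⁴` norm of the gradient on a set. -/
def l4grad (S : Set (ℝ × ℝ)) (f : ℝ × ℝ → ℝ) : ℝ :=
  (∫ q in S, (gradSq f q) ^ 2) ^ ((1 : ℝ) / 4)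

/-- Membership in the class `W`: continuous on `Ω̄`, layerwise `C²`, `L`-periodic in `x`,
vanishing at `z = 0` and `z = −H`, with `∂ₓψ` and `D ∂_zψ` continuous across the interfaces
(encoded by the existence of continuous extensions to `Ω̄`). -/
structure MemW (L H : ℝ) (l : ℕ) (z : ℕ → ℝ) (D : ℝ × ℝ → ℝ) (ψ : ℝ × ℝ → ℝ) : Prop where
  cont : ContinuousOn ψ (closure (Om L H))
  smooth : ∀ i < l, ContDiffOn ℝ 2 ψ (closure (strip L z i))
  per : ∀ x zz : ℝ, ψ (x + L, zz) = ψ (x, zz)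
  top : ∀ x : ℝ, ψ (x, 0) = 0
  bot : ∀ x : ℝ, ψ (x, -H) = 0
  dxCont : ∃ g : ℝ × ℝ → ℝ, ContinuousOn g (closure (Om L H)) ∧
    ∀ i < l, ∀ q ∈ strip L z i, g q = dX ψ q
  fluxCont : ∃ g : ℝ × ℝ → ℝ, ContinuousOn g (closure (Om L H)) ∧
    ∀ i < l, ∀ q ∈ strip L z i, g q = D q * dZ ψ q

/-- The `W`-norm `‖ψ‖_W = ‖ψ‖_{H¹} + ‖∂ₓψ‖_{H¹} + ‖D∂_zψ‖_{H¹}`. -/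
def wNorm (L H : ℝ) (D : ℝ × ℝ → ℝ) (ψ : ℝ × ℝ → ℝ) : ℝ :=
  h1 (Om L H) ψ + h1 (Om L H) (dX ψ) + h1 (Om L H) (fun q => D q * dZ ψ q)

/-- A one-dimensional trace inequality: a function with bounded derivative off a countable set is
pointwise controlled by the integrals of its square and of its product with the derivative. -/
theorem sq_le_integral_of_hasDerivAt {a b M : ℝ} (hab : a < b) {h h' : ℝ → ℝ} {S : Set ℝ}
    (hS : S.Countable) (hc : ContinuousOn h (Icc a b))
    (hd : ∀ x ∈ Ioo a b \ S, HasDerivAt h (h' x) x) (hm : Measurable h')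
    (hM : ∀ x ∈ Ioo a b \ S, |h' x| ≤ M) {x : ℝ} (hx : x ∈ Ioo a b) :
    (h x) ^ 2 ≤ ∫ y in Ioo a b, ((b - a)⁻¹ * (h y) ^ 2 + 2 * |h y * h' y|) := by
  have hsq : IntegrableOn (fun y => (h y) ^ 2) (Ioo a b) :=
    ((hc.pow 2).integrableOn_Icc).mono_set Ioo_subset_Icc_self
  have hSae : ∀ᵐ y ∂(volume.restrict (Ioo a b)), y ∈ Ioo a b \ S := by
    filter_upwards [ae_restrict_mem measurableSet_Ioo,
      ae_restrict_of_ae (hS.ae_notMem volume)] with y h1 h2 using ⟨h1, h2⟩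
  have hmul : IntegrableOn (fun y => h y * h' y) (Ioo a b) := by
    obtain ⟨N, hN⟩ := isCompact_Icc.exists_bound_of_continuousOn hc
    refine Integrable.of_bound (C := N * M) ?_ ?_
    · exact ((hc.mono Ioo_subset_Icc_self).aestronglyMeasurable measurableSet_Ioo).mul
        hm.aestronglyMeasurable
    · filter_upwards [hSae] with y hy
      rw [norm_mul]
      exact mul_le_mul (hN y (Ioo_subset_Icc_self hy.1)) (hM y hy) (norm_nonneg _)
        ((norm_nonneg _).trans (hN y (Ioo_subset_Icc_self hy.1)))
  have habs : IntegrableOn (fun y => 2 * |h y * h' y|) (Ioo a b) := hmul.norm.const_mul 2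
  have key : ∀ y ∈ Ioo a b,
      (h x) ^ 2 - (∫ t in Ioo a b, 2 * |h t * h' t|) ≤ (h y) ^ 2 := by
    intro y hy
    have hsub : uIcc y x ⊆ Ioo a b := (ordConnected_Ioo).uIcc_subset hy hx
    have hsub' : uIoc y x ⊆ Ioo a b := uIoc_subset_uIcc.trans hsub
    have e : ∫ t in y..x, 2 * (h t * h' t) = (h x) ^ 2 - (h y) ^ 2 := by
      refine integral_eq_of_hasDerivAt_off_countable (fun t => (h t) ^ 2) _ hS
        ((hc.pow 2).mono (hsub.trans Ioo_subset_Icc_self)) ?_ ?_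
      · intro t ht
        have h1 := (hd t ⟨hsub (Ioo_subset_Icc_self ht.1), ht.2⟩).fun_pow 2
        simpa [mul_assoc] using h1
      · rw [intervalIntegrable_iff]
        exact (hmul.mono_set hsub').const_mul 2
    have e2 := intervalIntegral.norm_integral_le_integral_norm_uIoc (a := y) (b := x)
      (f := fun t => 2 * (h t * h' t)) (μ := volume)
    have e3 : ∫ t in uIoc y x, ‖2 * (h t * h' t)‖ ≤ ∫ t in Ioo a b, 2 * |h t * h' t| := by
      have : (fun t => ‖2 * (h t * h' t)‖) = fun t => 2 * |h t * h' t| := by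
        ext t
        rw [norm_mul, Real.norm_eq_abs, Real.norm_eq_abs, abs_two]
      rw [this]
      exact setIntegral_mono_set habs (Filter.Eventually.of_forall fun t => by positivity)
        hsub'.eventuallyLE
    rw [e] at e2
    have := le_abs_self ((h x) ^ 2 - (h y) ^ 2)
    rw [Real.norm_eq_abs] at e2
    linarith
  have hmean := setIntegral_mono_on (μ := volume) (s := Ioo a b)
    (integrableOn_const (by simp)) hsq measurableSet_Ioo key
  rw [setIntegral_const] at hmean
  simp only [measureReal_def, Real.volume_Ioo, smul_eq_mul,
    ENNReal.toReal_ofReal (sub_nonneg.2 hab.le)] at hmean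
  rw [integral_add (hsq.const_mul _) habs, integral_const_mul]
  have hpos : 0 < b - a := sub_pos.2 hab
  rw [← sub_le_iff_le_add, inv_mul_eq_div, le_div_iff₀ hpos, mul_comm]
  exact hmean

/-- A function on a product dominated by a product of two slice integrals. -/
theorem integral_le_mul_of_slices {α β : Type*} [MeasurableSpace α] [MeasurableSpace β]
    {μ : Measure α} {ν : Measure β} [SFinite μ] [SFinite ν] {F P Q : α × β → ℝ}
    (hF : 0 ≤ F) (hP : Integrable P (μ.prod ν)) (hQ : Integrable Q (μ.prod ν))
    (h : ∀ᵐ w ∂(μ.prod ν), F w ≤ (∫ y, Q (w.1, y) ∂ν) * ∫ x, P (x, w.2) ∂μ) :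
    ∫ w, F w ∂(μ.prod ν) ≤ (∫ w, Q w ∂(μ.prod ν)) * ∫ w, P w ∂(μ.prod ν) := by
  rw [integral_prod Q hQ, integral_prod_symm P hP, ← integral_prod_mul]
  exact integral_mono_of_nonneg (Filter.Eventually.of_forall hF)
    (hQ.integral_prod_left.mul_prod hP.integral_prod_right) h

/-- Cauchy–Schwarz for the integral of `c f² + 2 |f k|`. -/
theorem integral_const_mul_sq_add_le {α : Type*} [MeasurableSpace α] {μ : Measure α}
    {f k : α → ℝ} (hf : MemLp f 2 μ) (hk : MemLp k 2 μ) (c : ℝ) :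
    ∫ w, (c * (f w) ^ 2 + 2 * |f w * k w|) ∂μ ≤
      c * (∫ w, (f w) ^ 2 ∂μ) + 2 * (√(∫ w, (f w) ^ 2 ∂μ) * √(∫ w, (k w) ^ 2 ∂μ)) := by
  have hfk : Integrable (fun w => f w * k w) μ := hf.integrable_mul hk
  rw [integral_add (hf.integrable_sq.const_mul c) (hfk.abs.const_mul 2), integral_const_mul,
    integral_const_mul]
  have h2 : ENNReal.ofReal 2 = 2 := by norm_num
  have := integral_mul_le_Lp_mul_Lq_of_nonneg (μ := μ) (Real.HolderConjugate.two_two)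
    (f := fun w => |f w|) (g := fun w => |k w|)
    (Filter.Eventually.of_forall fun w => abs_nonneg _)
    (Filter.Eventually.of_forall fun w => abs_nonneg _)
    (by rw [h2]; exact hf.abs) (by rw [h2]; exact hk.abs)
  simp only [Real.rpow_two, sq_abs, ← Real.sqrt_eq_rpow, ← abs_mul] at this
  linarith

theorem sqInt_nonneg (S : Set (ℝ × ℝ)) (f : ℝ × ℝ → ℝ) : 0 ≤ sqInt S f :=
  integral_nonneg fun _ => sq_nonneg _

theorem gradSq_nonneg (f : ℝ × ℝ → ℝ) (q : ℝ × ℝ) : 0 ≤ gradSq f q := by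
  unfold gradSq; positivity

theorem measurable_dX (f : ℝ × ℝ → ℝ) : Measurable (dX f) :=
  measurable_fderiv_apply_const ℝ f _

theorem measurable_dZ (f : ℝ × ℝ → ℝ) : Measurable (dZ f) :=
  measurable_fderiv_apply_const ℝ f _

theorem closure_Om {L H : ℝ} (hL : 0 < L) (hH : 0 < H) :
    closure (Om L H) = Icc 0 L ×ˢ Icc (-H) 0 := by
  rw [Om, closure_prod_eq, closure_Ioo hL.ne, closure_Ioo (by linarith)]

theorem measurableSet_Om (L H : ℝ) : MeasurableSet (Om L H) :=
  measurableSet_Ioo.prod measurableSet_Ioo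

theorem volume_restrict_Om (L H : ℝ) :
    (volume : Measure (ℝ × ℝ)).restrict (Om L H) =
      (volume.restrict (Ioo 0 L)).prod (volume.restrict (Ioo (-H) 0)) := by
  rw [Measure.prod_restrict, Om, Measure.volume_eq_prod]

theorem ae_mem_Om_of_countable (L H : ℝ) {S : Set ℝ} (hS : S.Countable) :
    ∀ᵐ q ∂(volume.restrict (Om L H) : Measure (ℝ × ℝ)), q ∈ Om L H ∧ q.2 ∉ S := by
  have h0 : ∀ᵐ q : ℝ × ℝ, q.2 ∉ S :=
    Measure.quasiMeasurePreserving_snd.ae (hS.ae_notMem volume)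
  filter_upwards [ae_restrict_mem (measurableSet_Om L H), ae_restrict_of_ae h0] with q h1 h2
    using ⟨h1, h2⟩

instance isFiniteMeasure_restrict_Om (L H : ℝ) :
    IsFiniteMeasure ((volume : Measure (ℝ × ℝ)).restrict (Om L H)) := by
  rw [volume_restrict_Om]
  infer_instance

theorem integrableOn_Om_of_continuousOn {L H : ℝ} {g : ℝ × ℝ → ℝ}
    (hg : ContinuousOn g (closure (Om L H))) : IntegrableOn g (Om L H) := by
  have hK : IsCompact (closure (Om L H)) := by
    rw [Om, closure_prod_eq]
    exact ((Metric.isBounded_Ioo _ _).isCompact_closure).prod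
      ((Metric.isBounded_Ioo _ _).isCompact_closure)
  exact (hg.integrableOn_compact hK).mono_set subset_closure

/-- Ladyzhenskaya's inequality on a rectangle, for a continuous function which is differentiable
with bounded gradient off countably many horizontal lines. -/
theorem integral_pow_four_le {L H : ℝ} (hL : 0 < L) (hH : 0 < H) {M : ℝ} {S : Set ℝ}
    (hS : S.Countable) {g : ℝ × ℝ → ℝ} (hg : ContinuousOn g (closure (Om L H)))
    (hd : ∀ q ∈ Om L H, q.2 ∉ S → DifferentiableAt ℝ g q)
    (hX : ∀ q ∈ Om L H, q.2 ∉ S → |dX g q| ≤ M)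
    (hZ : ∀ q ∈ Om L H, q.2 ∉ S → |dZ g q| ≤ M) :
    ∫ q in Om L H, (g q) ^ 4 ≤
      (L⁻¹ + 2) * (H⁻¹ + 2) * sqInt (Om L H) g * (h1 (Om L H) g) ^ 2 := by
  have hae := ae_mem_Om_of_countable L H hS
  have hgm : AEStronglyMeasurable g (volume.restrict (Om L H)) :=
    (integrableOn_Om_of_continuousOn hg).aestronglyMeasurable
  have hgL : MemLp g 2 (volume.restrict (Om L H)) :=
    (memLp_two_iff_integrable_sq hgm).2 (integrableOn_Om_of_continuousOn (hg.pow 2))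
  have hXL : MemLp (dX g) 2 (volume.restrict (Om L H)) :=
    MemLp.of_bound (measurable_dX g).aestronglyMeasurable M <| by
      filter_upwards [hae] with q hq using hX q hq.1 hq.2
  have hZL : MemLp (dZ g) 2 (volume.restrict (Om L H)) :=
    MemLp.of_bound (measurable_dZ g).aestronglyMeasurable M <| by
      filter_upwards [hae] with q hq using hZ q hq.1 hq.2
  set P : ℝ × ℝ → ℝ := fun q => L⁻¹ * (g q) ^ 2 + 2 * |g q * dX g q| with hPdef
  set Q : ℝ × ℝ → ℝ := fun q => H⁻¹ * (g q) ^ 2 + 2 * |g q * dZ g q| with hQdef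
  have hP : IntegrableOn P (Om L H) :=
    (hgL.integrable_sq.const_mul _).add ((hgL.integrable_mul hXL).abs.const_mul 2)
  have hQ : IntegrableOn Q (Om L H) :=
    (hgL.integrable_sq.const_mul _).add ((hgL.integrable_mul hZL).abs.const_mul 2)
  rw [closure_Om hL hH] at hg
  have hslices : ∀ᵐ q ∂(volume.restrict (Om L H) : Measure (ℝ × ℝ)), (g q) ^ 4 ≤
      (∫ y in Ioo (-H) 0, Q (q.1, y)) * ∫ x in Ioo 0 L, P (x, q.2) := by
    filter_upwards [hae] with q hq
    obtain ⟨⟨hq1, hq2⟩, hqS⟩ := hq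
    have hA : (g q) ^ 2 ≤ ∫ x in Ioo 0 L, P (x, q.2) := by
      have := sq_le_integral_of_hasDerivAt (h := fun x => g (x, q.2))
        (h' := fun x => dX g (x, q.2)) (M := M) hL countable_empty
        (hg.comp (by fun_prop) fun x hx => ⟨hx, Ioo_subset_Icc_self hq2⟩)
        (fun x hx => by
          have h1 := (hd (x, q.2) ⟨hx.1, hq2⟩ hqS).hasFDerivAt
          exact h1.comp_hasDerivAt x ((hasDerivAt_id x).prodMk (hasDerivAt_const x q.2)))
        ((measurable_dX g).comp (by fun_prop))
        (fun x hx => hX (x, q.2) ⟨hx.1, hq2⟩ hqS) hq1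
      simpa only [sub_zero] using this
    have hB : (g q) ^ 2 ≤ ∫ y in Ioo (-H) 0, Q (q.1, y) := by
      have := sq_le_integral_of_hasDerivAt (h := fun y => g (q.1, y))
        (h' := fun y => dZ g (q.1, y)) (M := M) (neg_lt_zero.2 hH) hS
        (hg.comp (by fun_prop) fun y hy => ⟨Ioo_subset_Icc_self hq1, hy⟩)
        (fun y hy => by
          have h1 := (hd (q.1, y) ⟨hq1, hy.1⟩ hy.2).hasFDerivAt
          exact h1.comp_hasDerivAt y ((hasDerivAt_const y q.1).prodMk (hasDerivAt_id y)))
        ((measurable_dZ g).comp (by fun_prop))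
        (fun y hy => hZ (q.1, y) ⟨hq1, hy.1⟩ hy.2) hq2
      simpa only [sub_neg_eq_add, zero_add] using this
    calc (g q) ^ 4 = (g q) ^ 2 * (g q) ^ 2 := by ring
      _ ≤ _ := mul_le_mul hB hA (sq_nonneg _) ((sq_nonneg _).trans hB)
  have hprod : ∫ q in Om L H, (g q) ^ 4 ≤ (∫ q in Om L H, Q q) * ∫ q in Om L H, P q := by
    rw [volume_restrict_Om] at hslices ⊢
    rw [IntegrableOn, volume_restrict_Om] at hP hQ
    exact integral_le_mul_of_slices (fun q => by positivity) hP hQ hslices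
  have hPle := integral_const_mul_sq_add_le hgL hXL L⁻¹
  have hQle := integral_const_mul_sq_add_le hgL hZL H⁻¹
  have hgrad : IntegrableOn (gradSq g) (Om L H) := hXL.integrable_sq.add hZL.integrable_sq
  have hXle : ∫ q in Om L H, (dX g q) ^ 2 ≤ ∫ q in Om L H, gradSq g q :=
    integral_mono hXL.integrable_sq hgrad fun q => by
      simp only [gradSq]; nlinarith [sq_nonneg (dZ g q)]
  have hZle : ∫ q in Om L H, (dZ g q) ^ 2 ≤ ∫ q in Om L H, gradSq g q :=
    integral_mono hZL.integrable_sq hgrad fun q => by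
      simp only [gradSq]; nlinarith [sq_nonneg (dX g q)]
  change _ ≤ L⁻¹ * sqInt (Om L H) g + 2 * (√(sqInt (Om L H) g) * _) at hPle
  change _ ≤ H⁻¹ * sqInt (Om L H) g + 2 * (√(sqInt (Om L H) g) * _) at hQle
  have hG := sqInt_nonneg (Om L H) g
  have hE : 0 ≤ ∫ q in Om L H, gradSq g q := integral_nonneg (gradSq_nonneg g)
  have hs : √(sqInt (Om L H) g) ≤ h1 (Om L H) g := Real.sqrt_le_sqrt (by linarith)
  have hX' : √(∫ q in Om L H, (dX g q) ^ 2) ≤ h1 (Om L H) g := Real.sqrt_le_sqrt (by linarith)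
  have hZ' : √(∫ q in Om L H, (dZ g q) ^ 2) ≤ h1 (Om L H) g := Real.sqrt_le_sqrt (by linarith)
  have hGs : sqInt (Om L H) g = √(sqInt (Om L H) g) * √(sqInt (Om L H) g) :=
    (Real.mul_self_sqrt hG).symm
  have bound : ∀ c : ℝ, 0 < c → ∀ r ≤ h1 (Om L H) g,
      c⁻¹ * sqInt (Om L H) g + 2 * (√(sqInt (Om L H) g) * r) ≤
        √(sqInt (Om L H) g) * ((c⁻¹ + 2) * h1 (Om L H) g) := by
    intro c hc r hr
    have e1 := mul_le_mul_of_nonneg_left hs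
      (mul_nonneg (inv_nonneg.2 hc.le) (Real.sqrt_nonneg (sqInt (Om L H) g)))
    have e2 := mul_le_mul_of_nonneg_left hr (Real.sqrt_nonneg (sqInt (Om L H) g))
    rw [mul_assoc, ← hGs] at e1
    linarith
  have hh : 0 ≤ h1 (Om L H) g := Real.sqrt_nonneg _
  calc _ ≤ _ := hprod
    _ ≤ (√(sqInt (Om L H) g) * ((H⁻¹ + 2) * h1 (Om L H) g)) *
        (√(sqInt (Om L H) g) * ((L⁻¹ + 2) * h1 (Om L H) g)) :=
      mul_le_mul (hQle.trans (bound H hH _ hZ')) (hPle.trans (bound L hL _ hX'))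
        (integral_nonneg fun q => by positivity) (by positivity)
    _ = (L⁻¹ + 2) * (H⁻¹ + 2) * (√(sqInt (Om L H) g) * √(sqInt (Om L H) g)) *
        (h1 (Om L H) g) ^ 2 := by ring
    _ = _ := by rw [← hGs]

theorem closure_strip {L : ℝ} {z : ℕ → ℝ} {i : ℕ} (hL : 0 < L) (hz : z i < z (i + 1)) :
    closure (strip L z i) = Icc 0 L ×ˢ Icc (z i) (z (i + 1)) := by
  rw [strip, closure_prod_eq, closure_Ioo hL.ne, closure_Ioo hz.ne]

theorem isOpen_strip (L : ℝ) (z : ℕ → ℝ) (i : ℕ) : IsOpen (strip L z i) :=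
  isOpen_Ioo.prod isOpen_Ioo

/-- A function that is `C²` up to the boundary of a layer has a differentiable gradient with
bounded derivative inside. -/
theorem exists_bound_fderiv_fderiv {L : ℝ} {z : ℕ → ℝ} {i : ℕ} (hL : 0 < L)
    (hz : z i < z (i + 1)) {ψ : ℝ × ℝ → ℝ} (hψ : ContDiffOn ℝ 2 ψ (closure (strip L z i))) :
    ∃ M, ∀ q ∈ strip L z i,
      DifferentiableAt ℝ (fderiv ℝ ψ) q ∧ ‖fderiv ℝ (fderiv ℝ ψ) q‖ ≤ M := by
  set T := closure (strip L z i) with hT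
  have hTe : T = Icc 0 L ×ˢ Icc (z i) (z (i + 1)) := closure_strip hL hz
  have hU : UniqueDiffOn ℝ T := by
    rw [hTe]
    exact (uniqueDiffOn_Icc hL).prod (uniqueDiffOn_Icc hz)
  have hK : IsCompact T := by
    rw [hTe]
    exact isCompact_Icc.prod isCompact_Icc
  have h1 : ContDiffOn ℝ 1 (fderivWithin ℝ ψ T) T := hψ.fderivWithin hU (by norm_num)
  obtain ⟨M, hM⟩ := hK.exists_bound_of_continuousOn (h1.continuousOn_fderivWithin hU le_rfl)
  refine ⟨M, fun q hq => ?_⟩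
  have hnhds : ∀ p ∈ strip L z i, T ∈ nhds p := fun p hp =>
    Filter.mem_of_superset ((isOpen_strip L z i).mem_nhds hp) subset_closure
  have heq : fderivWithin ℝ ψ T =ᶠ[nhds q] fderiv ℝ ψ := by
    filter_upwards [(isOpen_strip L z i).mem_nhds hq] with p hp
      using fderivWithin_of_mem_nhds (hnhds p hp)
  refine ⟨heq.differentiableAt_iff.1 ((h1.contDiffAt (hnhds q hq)).differentiableAt one_ne_zero),
    ?_⟩
  rw [← heq.fderiv_eq, ← fderivWithin_of_mem_nhds (hnhds q hq)]
  exact hM q (subset_closure hq)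

theorem exists_forall_lt_le (l : ℕ) (u : ℕ → ℝ) : ∃ M, ∀ i < l, u i ≤ M := by
  obtain ⟨M, hM⟩ := ((Set.finite_Iio l).image u).bddAbove
  exact ⟨M, fun i hi => hM (mem_image_of_mem u hi)⟩

theorem exists_pos_forall_lt_le (l : ℕ) (u : ℕ → ℝ) (hu : ∀ i < l, 0 < u i) :
    ∃ d > 0, ∀ i < l, d ≤ u i := by
  obtain ⟨M, hM⟩ := exists_forall_lt_le l fun i => (u i)⁻¹
  refine ⟨(max M 1)⁻¹, by positivity, fun i hi => ?_⟩
  exact inv_le_of_inv_le₀ (hu i hi) ((hM i hi).trans (le_max_left _ _))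

theorem exists_mem_Ioo_of_notMem_range {z : ℕ → ℝ} {t : ℝ} (ht : t ∉ range z) (h0 : z 0 < t) :
    ∀ n, t < z n → ∃ i < n, t ∈ Ioo (z i) (z (i + 1))
  | 0, hn => absurd hn h0.not_gt
  | n + 1, hn => by
    rcases lt_trichotomy t (z n) with h | h | h
    · obtain ⟨i, hi, hti⟩ := exists_mem_Ioo_of_notMem_range ht h0 n h
      exact ⟨i, hi.trans n.lt_succ_self, hti⟩
    · exact absurd ⟨n, h.symm⟩ ht
    · exact ⟨n, n.lt_succ_self, h, hn⟩

theorem Layers.exists_mem_strip {L H : ℝ} {l : ℕ} {z : ℕ → ℝ} (hz : Layers L H l z)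
    {q : ℝ × ℝ} (hq : q ∈ Om L H) (hqz : q.2 ∉ range z) : ∃ i < l, q ∈ strip L z i := by
  obtain ⟨i, hi, hqi⟩ := exists_mem_Ioo_of_notMem_range hqz (by rw [hz.z0]; exact hq.2.1) l
    (by rw [hz.zl]; exact hq.2.2)
  exact ⟨i, hi, hq.1, hqi⟩

theorem Layers.ae_exists_mem_strip {L H : ℝ} {l : ℕ} {z : ℕ → ℝ} (hz : Layers L H l z) :
    ∀ᵐ q ∂(volume.restrict (Om L H) : Measure (ℝ × ℝ)), ∃ i < l, q ∈ strip L z i := by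
  filter_upwards [ae_mem_Om_of_countable L H (countable_range z)] with q hq
    using hz.exists_mem_strip hq.1 hq.2

/-- Ladyzhenskaya's inequality for a function that is, on each layer, a multiple of a directional
derivative of a layerwise `C²` function, and has a continuous representative `g`. -/
theorem Layers.integral_pow_four_le_of_layerwise {L H : ℝ} {l : ℕ} {z : ℕ → ℝ}
    (hz : Layers L H l z) {ψ f g : ℝ × ℝ → ℝ} {c : ℕ → ℝ} {v : ℝ × ℝ}
    (hψ : ∀ i < l, ContDiffOn ℝ 2 ψ (closure (strip L z i)))
    (hg : ContinuousOn g (closure (Om L H)))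
    (hgf : ∀ i < l, ∀ q ∈ strip L z i, g q = f q)
    (hf : ∀ i < l, ∀ q ∈ strip L z i, f q = c i * fderiv ℝ ψ q v) :
    ∫ q in Om L H, (g q) ^ 4 ≤
      (L⁻¹ + 2) * (H⁻¹ + 2) * sqInt (Om L H) f * (h1 (Om L H) f) ^ 2 := by
  have hbound : ∀ i, ∃ M, i < l → ∀ q ∈ strip L z i,
      DifferentiableAt ℝ (fderiv ℝ ψ) q ∧ ‖fderiv ℝ (fderiv ℝ ψ) q‖ ≤ M := by
    intro i
    by_cases hi : i < l
    · obtain ⟨M, hM⟩ := exists_bound_fderiv_fderiv hz.hL (hz.mono i hi) (hψ i hi)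
      exact ⟨M, fun _ => hM⟩
    · exact ⟨0, fun h => absurd h hi⟩
  choose B hB using hbound
  obtain ⟨M, hM⟩ := exists_forall_lt_le l fun i => |c i| * (B i * ‖v‖)
  have heq : ∀ i < l, ∀ q ∈ strip L z i, g =ᶠ[nhds q] f := fun i hi q hq => by
    filter_upwards [(isOpen_strip L z i).mem_nhds hq] with p hp using hgf i hi p hp
  have hderiv : ∀ i < l, ∀ q ∈ strip L z i,
      HasFDerivAt g (c i • (fderiv ℝ (fderiv ℝ ψ) q).flip v) q := by
    intro i hi q hq
    have h1 : HasFDerivAt (fun p => c i * fderiv ℝ ψ p v)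
        (c i • (fderiv ℝ (fderiv ℝ ψ) q).flip v) q := by
      have h2 := ((hB i hi q hq).1.hasFDerivAt.clm_apply (hasFDerivAt_const v q)).const_mul (c i)
      simpa using h2
    refine h1.congr_of_eventuallyEq ?_
    filter_upwards [(isOpen_strip L z i).mem_nhds hq] with p hp
      using (hgf i hi p hp).trans (hf i hi p hp)
  have happly : ∀ w : ℝ × ℝ, ‖w‖ ≤ 1 → ∀ q ∈ Om L H, q.2 ∉ range z → |fderiv ℝ g q w| ≤ M := by
    intro w hw q hq hqz
    obtain ⟨i, hi, hqi⟩ := hz.exists_mem_strip hq hqz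
    rw [(hderiv i hi q hqi).fderiv]
    have h3 : ‖fderiv ℝ (fderiv ℝ ψ) q w v‖ ≤ B i * ‖v‖ := by
      refine ((fderiv ℝ (fderiv ℝ ψ) q).le_opNorm₂ w v).trans ?_
      have hle := (hB i hi q hqi).2
      have hB0 : 0 ≤ B i := (norm_nonneg (fderiv ℝ (fderiv ℝ ψ) q)).trans hle
      calc _ ≤ B i * 1 * ‖v‖ := by gcongr
        _ = B i * ‖v‖ := by rw [mul_one]
    calc |(c i • (fderiv ℝ (fderiv ℝ ψ) q).flip v) w|
        = |c i| * ‖fderiv ℝ (fderiv ℝ ψ) q w v‖ := by simp [abs_mul]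
      _ ≤ |c i| * (B i * ‖v‖) := mul_le_mul_of_nonneg_left h3 (abs_nonneg _)
      _ ≤ M := hM i hi
  have main := integral_pow_four_le hz.hL hz.hH (countable_range z) hg
    (fun q hq hqz => by
      obtain ⟨i, hi, hqi⟩ := hz.exists_mem_strip hq hqz
      exact (hderiv i hi q hqi).differentiableAt)
    (happly (1, 0) (by simp [Prod.norm_def])) (happly (0, 1) (by simp [Prod.norm_def]))
  have hsq : sqInt (Om L H) g = sqInt (Om L H) f := by
    refine integral_congr_ae ?_
    filter_upwards [hz.ae_exists_mem_strip] with q ⟨i, hi, hq⟩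
    rw [hgf i hi q hq]
  have hgrad : ∫ q in Om L H, gradSq g q = ∫ q in Om L H, gradSq f q := by
    refine integral_congr_ae ?_
    filter_upwards [hz.ae_exists_mem_strip] with q ⟨i, hi, hq⟩
    simp only [gradSq, dX, dZ, (heq i hi q hq).fderiv_eq]
  rwa [h1, hsq, hgrad] at main

/-- the Gagliardo–Nirenberg-type inequality
`‖∇ψ‖_{L⁴(Ω)} ≤ C ‖∇ψ‖_{L²(Ω)}^{1/2} ‖ψ‖_W^{1/2}` for `ψ ∈ W`, with a constant depending
only on `Ω` and the layerwise diffusivities `D_i`. -/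
theorem statement_1 (L H : ℝ) (hL : 0 < L) (hH : 0 < H) (l : ℕ) (hl : 0 < l)
    (Dv : ℕ → ℝ) (hDv : ∀ i < l, 0 < Dv i) :
    ∃ C > 0, ∀ z : ℕ → ℝ, Layers L H l z →
      ∀ D : ℝ × ℝ → ℝ, (∀ i < l, ∀ q ∈ strip L z i, D q = Dv i) →
        ∀ ψ : ℝ × ℝ → ℝ, MemW L H l z D ψ →
          l4grad (Om L H) ψ ≤
            C * Real.sqrt (l2grad (Om L H) ψ) * Real.sqrt (wNorm L H D ψ) := by
  obtain ⟨d, hd, hdle⟩ := exists_pos_forall_lt_le l Dv hDv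
  obtain ⟨M, hM⟩ := exists_forall_lt_le l Dv
  set K : ℝ := (L⁻¹ + 2) * (H⁻¹ + 2) with hK
  have hKpos : 0 < K := by positivity
  set A : ℝ := 2 * K + 2 * (d⁻¹) ^ 4 * K * M ^ 2 + 1 with hA
  have hApos : 0 < A := by positivity
  refine ⟨A ^ ((1 : ℝ) / 4), by positivity, fun z hz D hD ψ hψ => ?_⟩
  obtain ⟨g₁, hg₁c, hg₁⟩ := hψ.dxCont
  obtain ⟨g₂, hg₂c, hg₂⟩ := hψ.fluxCont
  have hae₁ : ∀ᵐ q ∂(volume.restrict (Om L H) : Measure (ℝ × ℝ)), g₁ q = dX ψ q := by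
    filter_upwards [hz.ae_exists_mem_strip] with q ⟨i, hi, hq⟩ using hg₁ i hi q hq
  have hae₂ : ∀ᵐ q ∂(volume.restrict (Om L H) : Measure (ℝ × ℝ)), g₂ q = D q * dZ ψ q := by
    filter_upwards [hz.ae_exists_mem_strip] with q ⟨i, hi, hq⟩ using hg₂ i hi q hq
  have hDae : ∀ᵐ q ∂(volume.restrict (Om L H) : Measure (ℝ × ℝ)), d ≤ D q ∧ D q ≤ M := by
    filter_upwards [hz.ae_exists_mem_strip] with q ⟨i, hi, hq⟩
    rw [hD i hi q hq]
    exact ⟨hdle i hi, hM i hi⟩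
  have hZae : ∀ᵐ q ∂(volume.restrict (Om L H) : Measure (ℝ × ℝ)),
      |dZ ψ q| ≤ d⁻¹ * |g₂ q| := by
    filter_upwards [hae₂, hDae] with q h2 hDq
    rw [h2, abs_mul, abs_of_pos (hd.trans_le hDq.1), inv_mul_eq_div, le_div_iff₀ hd, mul_comm]
    exact mul_le_mul_of_nonneg_right hDq.1 (abs_nonneg _)
  have h4₁ := hz.integral_pow_four_le_of_layerwise (v := (1, 0)) (c := fun _ => 1) (f := dX ψ)
    hψ.smooth hg₁c hg₁ (fun i _ q _ => (one_mul _).symm)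
  have h4₂ := hz.integral_pow_four_le_of_layerwise (v := (0, 1)) (c := Dv)
    (f := fun q => D q * dZ ψ q) hψ.smooth hg₂c hg₂ (fun i hi q hq => by rw [hD i hi q hq]; rfl)
  have i₁ (n : ℕ) : IntegrableOn (fun q => (g₁ q) ^ n) (Om L H) :=
    integrableOn_Om_of_continuousOn (hg₁c.pow n)
  have i₂ (n : ℕ) : IntegrableOn (fun q => (g₂ q) ^ n) (Om L H) :=
    integrableOn_Om_of_continuousOn (hg₂c.pow n)
  have hgradInt : IntegrableOn (gradSq ψ) (Om L H) := by
    refine Integrable.mono' ((i₁ 2).add ((i₂ 2).const_mul ((d⁻¹) ^ 2)))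
      (((measurable_dX ψ).pow_const 2).add
        ((measurable_dZ ψ).pow_const 2)).aestronglyMeasurable ?_
    filter_upwards [hae₁, hZae] with q h1 h2
    rw [Real.norm_of_nonneg (gradSq_nonneg ψ q)]
    have := pow_le_pow_left₀ (abs_nonneg _) h2 2
    rw [mul_pow, sq_abs, sq_abs] at this
    simp only [gradSq, Pi.add_apply, h1]
    linarith
  have hLg : (l2grad (Om L H) ψ) ^ 2 = ∫ q in Om L H, gradSq ψ q :=
    Real.sq_sqrt (integral_nonneg (gradSq_nonneg ψ))
  have hG₁ : sqInt (Om L H) (dX ψ) ≤ (l2grad (Om L H) ψ) ^ 2 := by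
    rw [hLg]
    refine integral_mono_of_nonneg (Filter.Eventually.of_forall fun q => sq_nonneg _) hgradInt
      (Filter.Eventually.of_forall fun q => ?_)
    simp only [gradSq]
    nlinarith [sq_nonneg (dZ ψ q)]
  have hG₂ : sqInt (Om L H) (fun q => D q * dZ ψ q) ≤ M ^ 2 * (l2grad (Om L H) ψ) ^ 2 := by
    rw [hLg, ← integral_const_mul]
    refine integral_mono_of_nonneg (Filter.Eventually.of_forall fun q => sq_nonneg _)
      (hgradInt.const_mul _) ?_
    filter_upwards [hDae] with q hq
    simp only [gradSq, mul_pow]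
    have := pow_le_pow_left₀ (hd.le.trans hq.1) hq.2 2
    nlinarith [mul_le_mul_of_nonneg_right this (sq_nonneg (dZ ψ q)),
      mul_nonneg (sq_nonneg M) (sq_nonneg (dX ψ q))]
  have hsplit : ∫ q in Om L H, (gradSq ψ q) ^ 2 ≤
      2 * (∫ q in Om L H, (g₁ q) ^ 4) + 2 * (d⁻¹) ^ 4 * ∫ q in Om L H, (g₂ q) ^ 4 := by
    rw [← integral_const_mul, ← integral_const_mul,
      ← integral_add ((i₁ 4).const_mul _) ((i₂ 4).const_mul _)]
    refine integral_mono_of_nonneg (Filter.Eventually.of_forall fun q => sq_nonneg _)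
      (((i₁ 4).const_mul _).add ((i₂ 4).const_mul _)) ?_
    filter_upwards [hae₁, hZae] with q h1 h2
    have h3 := pow_le_pow_left₀ (abs_nonneg _) h2 4
    rw [mul_pow, Even.pow_abs ⟨2, rfl⟩, Even.pow_abs ⟨2, rfl⟩] at h3
    simp only [gradSq, h1]
    nlinarith [sq_nonneg ((dX ψ q) ^ 2 - (dZ ψ q) ^ 2)]
  have n₀ : 0 ≤ h1 (Om L H) ψ := Real.sqrt_nonneg _
  have n₁ : 0 ≤ h1 (Om L H) (dX ψ) := Real.sqrt_nonneg _
  have n₂ : 0 ≤ h1 (Om L H) (fun q => D q * dZ ψ q) := Real.sqrt_nonneg _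
  have nW : 0 ≤ wNorm L H D ψ := by unfold wNorm; positivity
  have w₁ : (h1 (Om L H) (dX ψ)) ^ 2 ≤ (wNorm L H D ψ) ^ 2 :=
    pow_le_pow_left₀ n₁ (by unfold wNorm; linarith) 2
  have w₂ : (h1 (Om L H) (fun q => D q * dZ ψ q)) ^ 2 ≤ (wNorm L H D ψ) ^ 2 :=
    pow_le_pow_left₀ n₂ (by unfold wNorm; linarith) 2
  have nl : 0 ≤ l2grad (Om L H) ψ := Real.sqrt_nonneg _
  have b₁ : ∫ q in Om L H, (g₁ q) ^ 4 ≤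
      K * (l2grad (Om L H) ψ) ^ 2 * (wNorm L H D ψ) ^ 2 := by
    refine h4₁.trans ?_
    gcongr
  have b₂ : ∫ q in Om L H, (g₂ q) ^ 4 ≤
      K * (M ^ 2 * (l2grad (Om L H) ψ) ^ 2) * (wNorm L H D ψ) ^ 2 := by
    refine h4₂.trans ?_
    gcongr
  have hfinal : ∫ q in Om L H, (gradSq ψ q) ^ 2 ≤
      A * (√(l2grad (Om L H) ψ) * √(wNorm L H D ψ)) ^ 4 := by
    have e : (√(l2grad (Om L H) ψ) * √(wNorm L H D ψ)) ^ 4 =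
        (l2grad (Om L H) ψ) ^ 2 * (wNorm L H D ψ) ^ 2 := by
      rw [mul_pow, pow_mul _ 2 2, pow_mul _ 2 2, Real.sq_sqrt nl, Real.sq_sqrt nW]
    rw [e]
    have b₂' := mul_le_mul_of_nonneg_left b₂ (by positivity : 0 ≤ 2 * (d⁻¹) ^ 4)
    have := mul_nonneg (sq_nonneg (l2grad (Om L H) ψ)) (sq_nonneg (wNorm L H D ψ))
    rw [hA]
    linarith
  have hroot := Real.rpow_le_rpow (integral_nonneg fun q => sq_nonneg (gradSq ψ q)) hfinal
    (by norm_num : (0 : ℝ) ≤ 1 / 4)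
  rw [Real.mul_rpow hApos.le (by positivity), ← Real.rpow_natCast, ← Real.rpow_mul (by positivity)]
    at hroot
  norm_num at hroot
  rw [l4grad, mul_assoc]
  norm_num
  exact hroot
end
end

section
/- Let K^ε : (−2,2) → ℝ equal 1 on (1,2) ∪ (−2,−1) and ε on (−1,1), and let ψ₁ : [−2,2] → ℝ be the continuous function that is affine on each of [−2,−1], [−1,1], [1,2] with ψ₁(−2) = 0, ψ₁(−1) = 1, ψ₁(1) = −1, ψ₁(2) = 0. For each ε ∈ (0,1] there is a unique continuous function p^ε : [−2,2] → ℝ which is C² on each of the three closed subintervals, satisfies −(p^ε)'' + p^ε = ψ₁' on the interior of each subinterval, satisfies (p^ε)'(−2) + ψ₁(−2) = 0 and (p^ε)'(2) + ψ₁(2) = 0, and for which K^ε((p^ε)' + ψ₁) extends continuously across z = ±1. Moreover, there exist a continuous function p⁰ : [−2,2] → ℝ, C² on each subinterval, solving −(p⁰)'' + p⁰ = ψ₁' on each subinterval with (p⁰)'(±2) + ψ₁(±2) = 0 and with ((p⁰)' + ψ₁)(±1) = 0 when evaluated from the outer subintervals, and a constant C > 0 such that for all ε ∈ (0,1]: (∫_{−2}^{2}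 |p^ε − p⁰|² + |(p^ε)' − (p⁰)'|² dz)^{1/2} ≤ C ε. -/
open MeasureTheory Set

noncomputable section

/-- The continuous piecewise-affine datum `ψ₁` on `[−2,2]` with
`ψ₁(−2) = 0, ψ₁(−1) = 1, ψ₁(1) = −1, ψ₁(2) = 0`. -/
def psi1 (s : ℝ) : ℝ := if s ≤ -1 then s + 2 else if s ≤ 1 then -s else s - 2

/-- A solution `p^ε` of the one-dimensional model problem with permeability `K^ε`
(equal to `1` on `(1,2) ∪ (−2,−1)` and `ε` on `(−1,1)`): continuous on `[−2,2]`, `C²` on each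
of the three closed subintervals, satisfying `−p'' + p = ψ₁'` in the interior of each
subinterval, the boundary conditions `p'(±2) + ψ₁(±2) = 0`, and continuity of the flux
`K^ε(p' + ψ₁)` across `z = ±1` (one-sided derivatives). -/
def EpsSol (ε : ℝ) (p : ℝ → ℝ) : Prop :=
  ContinuousOn p (Set.Icc (-2 : ℝ) 2) ∧
  ContDiffOn ℝ 2 p (Set.Icc (-2 : ℝ) (-1)) ∧
  ContDiffOn ℝ 2 p (Set.Icc (-1 : ℝ) 1) ∧
  ContDiffOn ℝ 2 p (Set.Icc (1 : ℝ) 2) ∧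
  (∀ s ∈ Set.Ioo (-2 : ℝ) (-1), -(deriv (deriv p) s) + p s = deriv psi1 s) ∧
  (∀ s ∈ Set.Ioo (-1 : ℝ) 1, -(deriv (deriv p) s) + p s = deriv psi1 s) ∧
  (∀ s ∈ Set.Ioo (1 : ℝ) 2, -(deriv (deriv p) s) + p s = deriv psi1 s) ∧
  derivWithin p (Set.Icc (-2 : ℝ) (-1)) (-2) + psi1 (-2) = 0 ∧
  derivWithin p (Set.Icc (1 : ℝ) 2) 2 + psi1 2 = 0 ∧
  1 * (derivWithin p (Set.Icc (-2 : ℝ) (-1)) (-1) + psi1 (-1)) =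
    ε * (derivWithin p (Set.Icc (-1 : ℝ) 1) (-1) + psi1 (-1)) ∧
  ε * (derivWithin p (Set.Icc (-1 : ℝ) 1) 1 + psi1 1) =
    1 * (derivWithin p (Set.Icc (1 : ℝ) 2) 1 + psi1 1)

/-- The limit solution `p⁰`: continuous on `[−2,2]`, `C²` on each closed subinterval,
solving `−p'' + p = ψ₁'` in the interior of each subinterval with `p'(±2) + ψ₁(±2) = 0`,
and with vanishing flux `(p' + ψ₁)(±1) = 0` evaluated from the outer subintervals. -/
def LimSol (p : ℝ → ℝ) : Prop :=
  ContinuousOn p (Set.Icc (-2 : ℝ) 2) ∧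
  ContDiffOn ℝ 2 p (Set.Icc (-2 : ℝ) (-1)) ∧
  ContDiffOn ℝ 2 p (Set.Icc (-1 : ℝ) 1) ∧
  ContDiffOn ℝ 2 p (Set.Icc (1 : ℝ) 2) ∧
  (∀ s ∈ Set.Ioo (-2 : ℝ) (-1), -(deriv (deriv p) s) + p s = deriv psi1 s) ∧
  (∀ s ∈ Set.Ioo (-1 : ℝ) 1, -(deriv (deriv p) s) + p s = deriv psi1 s) ∧
  (∀ s ∈ Set.Ioo (1 : ℝ) 2, -(deriv (deriv p) s) + p s = deriv psi1 s) ∧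
  derivWithin p (Set.Icc (-2 : ℝ) (-1)) (-2) + psi1 (-2) = 0 ∧
  derivWithin p (Set.Icc (1 : ℝ) 2) 2 + psi1 2 = 0 ∧
  derivWithin p (Set.Icc (-2 : ℝ) (-1)) (-1) + psi1 (-1) = 0 ∧
  derivWithin p (Set.Icc (1 : ℝ) 2) 1 + psi1 1 = 0

open Real in
/-- The general solution `c + A cosh (s - m) + B sinh (s - m)` of `-p'' + p = c`. -/
def hypSol (c m A B s : ℝ) : ℝ := c + A * cosh (s - m) + B * sinh (s - m)

lemma hasDerivAt_hypSol (c m A B s : ℝ) :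
    HasDerivAt (hypSol c m A B) (hypSol 0 m B A s) s := by
  have h : HasDerivAt (fun x : ℝ => x - m) 1 s := (hasDerivAt_id s).sub_const m
  have := ((h.cosh.const_mul A).const_add c).add (h.sinh.const_mul B)
  refine this.congr_deriv ?_
  simp only [hypSol]
  ring

lemma contDiff_hypSol (c m A B : ℝ) : ContDiff ℝ 2 (hypSol c m A B) := by
  have h : ContDiff ℝ 2 (fun x : ℝ => x - m) := by fun_prop
  exact (contDiff_const.add (contDiff_const.mul h.cosh)).add (contDiff_const.mul h.sinh)

section Pieces

variable {p : ℝ → ℝ} {a b c m A B : ℝ}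

lemma deriv_of_eqOn_hypSol (h : EqOn p (hypSol c m A B) (Icc a b)) {s : ℝ} (hs : s ∈ Ioo a b) :
    deriv p s = hypSol 0 m B A s := by
  have : p =ᶠ[nhds s] hypSol c m A B :=
    Filter.eventuallyEq_of_mem (Icc_mem_nhds hs.1 hs.2) h
  rw [this.deriv_eq, (hasDerivAt_hypSol c m A B s).deriv]

lemma ode_of_eqOn_hypSol (h : EqOn p (hypSol c m A B) (Icc a b)) {s : ℝ} (hs : s ∈ Ioo a b) :
    -(deriv (deriv p) s) + p s = c := by
  have : deriv p =ᶠ[nhds s] hypSol 0 m B A :=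
    Filter.eventuallyEq_of_mem (Ioo_mem_nhds hs.1 hs.2) fun _ => deriv_of_eqOn_hypSol h
  rw [this.deriv_eq, (hasDerivAt_hypSol 0 m B A s).deriv, h (Ioo_subset_Icc_self hs)]
  simp only [hypSol]
  ring

lemma derivWithin_of_eqOn_hypSol (hab : a < b) (h : EqOn p (hypSol c m A B) (Icc a b)) {s : ℝ}
    (hs : s ∈ Icc a b) : derivWithin p (Icc a b) s = hypSol 0 m B A s := by
  rw [derivWithin_congr h (h hs),
    (hasDerivAt_hypSol c m A B s).hasDerivWithinAt.derivWithin (uniqueDiffOn_Icc hab s hs)]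

lemma eq_left_of_hasDerivAt_zero {f : ℝ → ℝ} (hf : ContinuousOn f (Icc a b))
    (hf' : ∀ x ∈ Ioo a b, HasDerivAt f 0 x) {x : ℝ} (hx : x ∈ Icc a b) : f x = f a := by
  rcases hx.1.eq_or_lt with rfl | hax
  · rfl
  · obtain ⟨y, -, hy⟩ := exists_hasDerivAt_eq_slope f (fun _ => 0) hax
      (hf.mono (Icc_subset_Icc_right hx.2)) fun y hy => hf' y ⟨hy.1, hy.2.trans_le hx.2⟩
    have := sub_pos.2 hax
    field_simp at hy
    linarith

lemma exists_eqOn_hypSol (hab : a < b) (hp : ContDiffOn ℝ 2 p (Icc a b))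
    (ode : ∀ s ∈ Ioo a b, -(deriv (deriv p) s) + p s = c) (m : ℝ) :
    ∃ A B, EqOn p (hypSol c m A B) (Icc a b) := by
  set p' := derivWithin p (Icc a b)
  have hc' : ContinuousOn p' (Icc a b) :=
    hp.continuousOn_derivWithin (uniqueDiffOn_Icc hab) (by norm_num)
  have hc := hp.continuousOn
  have hd : ∀ s ∈ Ioo a b, HasDerivAt p (p' s) s := fun s hs => by
    have := (hp.differentiableOn (by norm_num) s (Ioo_subset_Icc_self hs)).hasDerivWithinAt
    exact this.hasDerivAt (Icc_mem_nhds hs.1 hs.2)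
  have hd' : ∀ s ∈ Ioo a b, HasDerivAt p' (p s - c) s := fun s hs => by
    have hev : deriv p =ᶠ[nhds s] p' :=
      Filter.eventuallyEq_of_mem (Ioo_mem_nhds hs.1 hs.2) fun x hx => (hd x hx).deriv
    have h1 : ContDiffOn ℝ 1 p' (Icc a b) :=
      hp.derivWithin (uniqueDiffOn_Icc hab) (by norm_num)
    have h2 := (h1.differentiableOn (by norm_num) s (Ioo_subset_Icc_self hs)).differentiableAt
      (Icc_mem_nhds hs.1 hs.2)
    refine h2.hasDerivAt.congr_deriv ?_
    rw [← hev.deriv_eq]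
    linarith [ode s hs]
  have hm (s : ℝ) : HasDerivAt (fun x : ℝ => x - m) 1 s := (hasDerivAt_id s).sub_const m
  let F : ℝ → ℝ := fun s => (p s - c) * Real.cosh (s - m) - p' s * Real.sinh (s - m)
  let G : ℝ → ℝ := fun s => p' s * Real.cosh (s - m) - (p s - c) * Real.sinh (s - m)
  have hF : ∀ s ∈ Icc a b, F s = F a := fun s hs => by
    refine eq_left_of_hasDerivAt_zero (by fun_prop) (fun x hx => ?_) hs
    have := (((hd x hx).sub_const c).mul (hm x).cosh).sub ((hd' x hx).mul (hm x).sinh)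
    exact this.congr_deriv (by ring)
  have hG : ∀ s ∈ Icc a b, G s = G a := fun s hs => by
    refine eq_left_of_hasDerivAt_zero (by fun_prop) (fun x hx => ?_) hs
    have := ((hd' x hx).mul (hm x).cosh).sub (((hd x hx).sub_const c).mul (hm x).sinh)
    exact this.congr_deriv (by ring)
  refine ⟨F a, G a, fun s hs => ?_⟩
  rw [hypSol, ← hF s hs, ← hG s hs]
  simp only [F, G]
  linear_combination (c - p s) * Real.cosh_sq_sub_sinh_sq (s - m)

end Pieces

lemma deriv_psi1_left {s : ℝ} (hs : s ∈ Ioo (-2 : ℝ) (-1)) : deriv psi1 s = 1 := by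
  have : psi1 =ᶠ[nhds s] fun x => x + 2 :=
    Filter.eventuallyEq_of_mem (Ioo_mem_nhds hs.1 hs.2) fun x hx => by simp [psi1, hx.2.le]
  rw [this.deriv_eq]
  simp

lemma deriv_psi1_mid {s : ℝ} (hs : s ∈ Ioo (-1 : ℝ) 1) : deriv psi1 s = -1 := by
  have : psi1 =ᶠ[nhds s] fun x => -x :=
    Filter.eventuallyEq_of_mem (Ioo_mem_nhds hs.1 hs.2) fun x hx => by
      simp [psi1, hx.2.le, hx.1.not_ge]
  rw [this.deriv_eq]
  simp

lemma deriv_psi1_right {s : ℝ} (hs : s ∈ Ioo (1 : ℝ) 2) : deriv psi1 s = 1 := by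
  have : psi1 =ᶠ[nhds s] fun x => x - 2 :=
    Filter.eventuallyEq_of_mem (Ioo_mem_nhds hs.1 hs.2) fun x hx => by
      simp [psi1, hx.1.not_ge, (show ¬ x ≤ -1 by linarith [hx.1])]
  rw [this.deriv_eq]
  simp

/-- `p` is the even function built from the outer amplitude `A` and the inner amplitude that
makes it continuous at `±1`. -/
def IsEvenProfile (A : ℝ) (p : ℝ → ℝ) : Prop :=
  EqOn p (hypSol 1 (-2) A 0) (Icc (-2) (-1)) ∧
  EqOn p (hypSol (-1) 0 (A + 2 / Real.cosh 1) 0) (Icc (-1) 1) ∧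
  EqOn p (hypSol 1 2 A 0) (Icc 1 2)

lemma exists_isEvenProfile (A : ℝ) : ∃ p, IsEvenProfile A p := by
  have hC := Real.cosh_pos 1
  refine ⟨fun s => if s ≤ -1 then hypSol 1 (-2) A 0 s else
    if s ≤ 1 then hypSol (-1) 0 (A + 2 / Real.cosh 1) 0 s else hypSol 1 2 A 0 s,
    fun s hs => by simp [hs.2], fun s hs => ?_, fun s hs => ?_⟩
  · rcases hs.1.eq_or_lt with rfl | h
    · norm_num [hypSol]
      field_simp
      ring
    · simp [hs.2, h.not_ge]
  · rcases hs.1.eq_or_lt with rfl | h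
    · norm_num [hypSol]
      field_simp
      ring
    · simp [h.not_ge, (show ¬ s ≤ -1 by linarith)]

lemma IsEvenProfile.eqOn {A : ℝ} {p q : ℝ → ℝ} (hq : IsEvenProfile A q)
    (hp : IsEvenProfile A p) : EqOn q p (Icc (-2) 2) := fun s hs => by
  rcases le_total s (-1) with h | h
  · rw [hq.1 ⟨hs.1, h⟩, hp.1 ⟨hs.1, h⟩]
  · rcases le_total s 1 with h' | h'
    · rw [hq.2.1 ⟨h, h'⟩, hp.2.1 ⟨h, h'⟩]
    · rw [hq.2.2 ⟨h', hs.2⟩, hp.2.2 ⟨h', hs.2⟩]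

lemma IsEvenProfile.contDiffOn {A : ℝ} {p : ℝ → ℝ} (h : IsEvenProfile A p) :
    ContDiffOn ℝ 2 p (Icc (-2) (-1)) ∧ ContDiffOn ℝ 2 p (Icc (-1) 1) ∧
      ContDiffOn ℝ 2 p (Icc 1 2) :=
  ⟨(contDiff_hypSol ..).contDiffOn.congr h.1, (contDiff_hypSol ..).contDiffOn.congr h.2.1,
    (contDiff_hypSol ..).contDiffOn.congr h.2.2⟩

lemma IsEvenProfile.continuousOn {A : ℝ} {p : ℝ → ℝ} (h : IsEvenProfile A p) :
    ContinuousOn p (Icc (-2) 2) := by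
  obtain ⟨h1, h2, h3⟩ := h.contDiffOn
  have := (h1.continuousOn.union_of_isClosed h2.continuousOn isClosed_Icc
    isClosed_Icc).union_of_isClosed h3.continuousOn (isClosed_Icc.union isClosed_Icc) isClosed_Icc
  rwa [Icc_union_Icc_eq_Icc (by norm_num) (by norm_num),
    Icc_union_Icc_eq_Icc (by norm_num) (by norm_num)] at this

/-- The outer amplitude of the solution with permeability `ε` in the middle layer. -/
def outerAmplitude (ε : ℝ) : ℝ :=
  -(1 + ε * (2 * (Real.sinh 1 / Real.cosh 1) - 1)) / ((1 + ε) * Real.sinh 1)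

lemma IsEvenProfile.epsSol {ε : ℝ} (hε : 0 ≤ ε) {p : ℝ → ℝ}
    (h : IsEvenProfile (outerAmplitude ε) p) : EpsSol ε p := by
  have hC := Real.cosh_pos 1
  have hS : 0 < Real.sinh 1 := Real.sinh_pos_iff.2 one_pos
  obtain ⟨h1, h2, h3⟩ := h.contDiffOn
  refine ⟨h.continuousOn, h1, h2, h3, fun s hs => ?_, fun s hs => ?_, fun s hs => ?_,
    ?_, ?_, ?_, ?_⟩
  · rw [ode_of_eqOn_hypSol h.1 hs, deriv_psi1_left hs]
  · rw [ode_of_eqOn_hypSol h.2.1 hs, deriv_psi1_mid hs]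
  · rw [ode_of_eqOn_hypSol h.2.2 hs, deriv_psi1_right hs]
  · rw [derivWithin_of_eqOn_hypSol (by norm_num) h.1 (by norm_num)]
    norm_num [hypSol, psi1]
  · rw [derivWithin_of_eqOn_hypSol (by norm_num) h.2.2 (by norm_num)]
    norm_num [hypSol, psi1]
  · rw [derivWithin_of_eqOn_hypSol (by norm_num) h.1 (by norm_num),
      derivWithin_of_eqOn_hypSol (by norm_num) h.2.1 (by norm_num)]
    norm_num [hypSol, psi1, outerAmplitude]
    field_simp
    ring
  · rw [derivWithin_of_eqOn_hypSol (by norm_num) h.2.2 (by norm_num),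
      derivWithin_of_eqOn_hypSol (by norm_num) h.2.1 (by norm_num)]
    norm_num [hypSol, psi1, outerAmplitude]
    field_simp
    ring

lemma EpsSol.limSol {p : ℝ → ℝ} (h : EpsSol 0 p) : LimSol p := by
  obtain ⟨h1, h2, h3, h4, h5, h6, h7, h8, h9, h10, h11⟩ := h
  exact ⟨h1, h2, h3, h4, h5, h6, h7, h8, h9, by linarith, by linarith⟩

lemma EpsSol.isEvenProfile {ε : ℝ} (hε : 0 ≤ ε) {p : ℝ → ℝ} (h : EpsSol ε p) :
    IsEvenProfile (outerAmplitude ε) p := by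
  obtain ⟨-, c1, c2, c3, o1, o2, o3, l, r, f1, f2⟩ := h
  obtain ⟨A₁, B₁, e1⟩ := exists_eqOn_hypSol (by norm_num) c1
    (fun s hs => (o1 s hs).trans (deriv_psi1_left hs)) (-2)
  obtain ⟨D, E, e2⟩ := exists_eqOn_hypSol (by norm_num) c2
    (fun s hs => (o2 s hs).trans (deriv_psi1_mid hs)) 0
  obtain ⟨A₂, B₂, e3⟩ := exists_eqOn_hypSol (by norm_num) c3
    (fun s hs => (o3 s hs).trans (deriv_psi1_right hs)) 2
  have hC := Real.cosh_pos 1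
  have hS : 0 < Real.sinh 1 := Real.sinh_pos_iff.2 one_pos
  have g1 := (e1 (x := -1) (by norm_num)).symm.trans (e2 (by norm_num))
  have g2 := (e2 (x := 1) (by norm_num)).symm.trans (e3 (by norm_num))
  rw [derivWithin_of_eqOn_hypSol (by norm_num) e1 (by norm_num)] at l
  rw [derivWithin_of_eqOn_hypSol (by norm_num) e3 (by norm_num)] at r
  rw [derivWithin_of_eqOn_hypSol (by norm_num) e1 (by norm_num),
    derivWithin_of_eqOn_hypSol (by norm_num) e2 (by norm_num)] at f1
  rw [derivWithin_of_eqOn_hypSol (by norm_num) e2 (by norm_num),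
    derivWithin_of_eqOn_hypSol (by norm_num) e3 (by norm_num)] at f2
  norm_num [hypSol, psi1] at l r g1 g2 f1 f2
  subst l r
  norm_num at g1 g2 f1 f2
  unfold IsEvenProfile outerAmplitude
  set C := Real.cosh 1
  set S := Real.sinh 1
  have hE : E = 0 := by
    have h0 : E * (S ^ 2 + ε * C ^ 2) = 0 := by
      linear_combination (S / 2) * g1 + (S / 2) * g2 - (C / 2) * f1 + (C / 2) * f2
    exact (mul_eq_zero.1 h0).resolve_right (by positivity)
  subst hE
  have hA : A₂ = A₁ := mul_right_cancel₀ hC.ne' (by linarith)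
  subst hA
  have hD : D = A₂ + 2 / C := by
    field_simp
    linarith
  have hA : A₂ = -(1 + ε * (2 * (S / C) - 1)) / ((1 + ε) * S) := by
    rw [hD] at f1
    field_simp at f1 ⊢
    linarith
  rw [← hA, ← hD]
  exact ⟨e1, e2, e3⟩

lemma abs_outerAmplitude_sub_le {ε : ℝ} (hε : 0 ≤ ε) :
    |outerAmplitude ε - outerAmplitude 0| ≤ 2 / Real.sinh 1 * ε := by
  have hC := Real.cosh_pos 1
  have hS : 0 < Real.sinh 1 := Real.sinh_pos_iff.2 one_pos
  have hlt : Real.sinh 1 < Real.cosh 1 := Real.sinh_lt_cosh 1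
  have h : outerAmplitude ε - outerAmplitude 0 =
      2 / Real.sinh 1 * ε * ((1 - Real.sinh 1 / Real.cosh 1) / (1 + ε)) := by
    unfold outerAmplitude
    field_simp
    ring
  have h0 : 0 ≤ 1 - Real.sinh 1 / Real.cosh 1 := sub_nonneg.2 ((div_le_one hC).2 hlt.le)
  have h1 : (1 - Real.sinh 1 / Real.cosh 1) / (1 + ε) ≤ 1 := by
    rw [div_le_one (by positivity)]
    linarith [div_pos hS hC]
  rw [h, abs_of_nonneg (by positivity)]
  exact mul_le_of_le_one_right (by positivity) h1

lemma hypSol_sq_add_sq_le {c m A A' s : ℝ} (hs : |s - m| ≤ 1) :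
    (hypSol c m A 0 s - hypSol c m A' 0 s) ^ 2 + (hypSol 0 m 0 A s - hypSol 0 m 0 A' s) ^ 2 ≤
      2 * Real.cosh 1 ^ 2 * (A - A') ^ 2 := by
  have h1 : Real.cosh (s - m) ≤ Real.cosh 1 := Real.cosh_le_cosh.2 (by simpa using hs)
  have h2 : Real.cosh (s - m) ^ 2 ≤ Real.cosh 1 ^ 2 :=
    pow_le_pow_left₀ (Real.cosh_pos _).le h1 2
  have h3 := Real.cosh_sq_sub_sinh_sq (s - m)
  have h4 : (A - A') ^ 2 * (Real.cosh (s - m) ^ 2 + Real.sinh (s - m) ^ 2) ≤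
      (A - A') ^ 2 * (2 * Real.cosh 1 ^ 2) :=
    mul_le_mul_of_nonneg_left (by linarith) (sq_nonneg _)
  simp only [hypSol]
  linarith

lemma IsEvenProfile.sq_add_sq_le {A A' : ℝ} {p q : ℝ → ℝ} (hp : IsEvenProfile A p)
    (hq : IsEvenProfile A' q) {s : ℝ} (hs : s ∈ Ioo (-2 : ℝ) 2) (h1 : s ≠ -1) (h2 : s ≠ 1) :
    (p s - q s) ^ 2 + (deriv p s - deriv q s) ^ 2 ≤ 2 * Real.cosh 1 ^ 2 * (A - A') ^ 2 := by
  have key {a b c m A A' : ℝ} (hp : EqOn p (hypSol c m A 0) (Icc a b))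
      (hq : EqOn q (hypSol c m A' 0) (Icc a b)) (hs : s ∈ Ioo a b) (hm : |s - m| ≤ 1) :
      (p s - q s) ^ 2 + (deriv p s - deriv q s) ^ 2 ≤ 2 * Real.cosh 1 ^ 2 * (A - A') ^ 2 := by
    rw [deriv_of_eqOn_hypSol hp hs, deriv_of_eqOn_hypSol hq hs, hp (Ioo_subset_Icc_self hs),
      hq (Ioo_subset_Icc_self hs)]
    exact hypSol_sq_add_sq_le hm
  rcases h1.lt_or_gt with h | h
  · exact key hp.1 hq.1 ⟨hs.1, h⟩ (abs_le.2 ⟨by linarith [hs.1], by linarith⟩)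
  · rcases h2.lt_or_gt with h' | h'
    · refine (key hp.2.1 hq.2.1 ⟨h, h'⟩ (abs_le.2 ⟨by linarith, by linarith⟩)).trans_eq ?_
      ring
    · exact key hp.2.2 hq.2.2 ⟨h', hs.2⟩ (abs_le.2 ⟨by linarith, by linarith [hs.2]⟩)

lemma IsEvenProfile.integral_le {A A' : ℝ} {p q : ℝ → ℝ} (hp : IsEvenProfile A p)
    (hq : IsEvenProfile A' q) :
    ∫ s in Ioo (-2 : ℝ) 2, ((p s - q s) ^ 2 + (deriv p s - deriv q s) ^ 2) ≤
      8 * Real.cosh 1 ^ 2 * (A - A') ^ 2 := by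
  have hae : ∀ᵐ s ∂(volume : Measure ℝ), s ∈ Ioo (-2 : ℝ) 2 →
      ‖(p s - q s) ^ 2 + (deriv p s - deriv q s) ^ 2‖ ≤
        2 * Real.cosh 1 ^ 2 * (A - A') ^ 2 := by
    filter_upwards [Measure.ae_ne volume (-1 : ℝ), Measure.ae_ne volume (1 : ℝ)] with s h1 h2 hs
    rw [Real.norm_of_nonneg (by positivity)]
    exact hp.sq_add_sq_le hq hs h1 h2
  have := norm_setIntegral_le_of_norm_le_const_ae' (by simp) hae
  rw [Real.volume_real_Ioo_of_le (by norm_num)] at this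
  refine (le_abs_self _).trans (this.trans_eq ?_)
  ring

/-- Appendix A: for every `ε ∈ (0,1]` the one-dimensional model problem has
a solution `p^ε`, unique on `[−2,2]`; moreover there are a limit solution `p⁰` and a constant
`C > 0` such that `‖p^ε − p⁰‖_{H¹(−2,2)} ≤ C ε` for all `ε ∈ (0,1]`, the derivatives being
taken piecewise. -/
theorem statement_13 :
    (∀ ε ∈ Set.Ioc (0 : ℝ) 1, ∃ p : ℝ → ℝ, EpsSol ε p ∧
      ∀ q : ℝ → ℝ, EpsSol ε q → Set.EqOn q p (Set.Icc (-2 : ℝ) 2)) ∧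
    ∃ p0 : ℝ → ℝ, LimSol p0 ∧ ∃ C > 0, ∀ ε ∈ Set.Ioc (0 : ℝ) 1, ∀ p : ℝ → ℝ, EpsSol ε p →
      Real.sqrt (∫ s in Set.Ioo (-2 : ℝ) 2,
          ((p s - p0 s) ^ 2 + (deriv p s - deriv p0 s) ^ 2)) ≤ C * ε := by
  refine ⟨fun ε hε => ?_, ?_⟩
  · obtain ⟨p, hp⟩ := exists_isEvenProfile (outerAmplitude ε)
    exact ⟨p, hp.epsSol hε.1.le, fun q hq => (hq.isEvenProfile hε.1.le).eqOn hp⟩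
  · obtain ⟨p0, hp0⟩ := exists_isEvenProfile (outerAmplitude 0)
    have hC := Real.cosh_pos 1
    have hS : 0 < Real.sinh 1 := Real.sinh_pos_iff.2 one_pos
    refine ⟨p0, (hp0.epsSol le_rfl).limSol, 3 * Real.cosh 1 * (2 / Real.sinh 1), by positivity,
      fun ε hε p hp => ?_⟩
    have hε0 : 0 ≤ ε := hε.1.le
    refine Real.sqrt_le_iff.2 ⟨by positivity, ?_⟩
    refine ((hp.isEvenProfile hε0).integral_le hp0).trans ?_
    have h := pow_le_pow_left₀ (abs_nonneg _) (abs_outerAmplitude_sub_le hε0) 2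
    rw [sq_abs] at h
    calc _ ≤ (3 * Real.cosh 1) ^ 2 * (outerAmplitude ε - outerAmplitude 0) ^ 2 := by
          gcongr
          linarith [sq_nonneg (Real.cosh 1)]
      _ ≤ (3 * Real.cosh 1) ^ 2 * (2 / Real.sinh 1 * ε) ^ 2 := by gcongr
      _ = _ := by ring
end
end
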